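/- Let N ≥ 1 be an integer, l ∈ ℤ, and τ ∈ ℂ with Im τ > 0, and write τ₂ := Im τ. Define ψ^{(l)}(x,y) := exp(iπNτy²)·θ_{l/N}(N(x+τy), Nτ). Then for every y ∈ ℝ, the x-integrated probability density is ∫₀¹ |ψ^{(l)}(x,y)|² dx = Σ_{n∈ℤ} exp(−2πNτ₂·(y + n + l/N)²). -/

import Mathlib

open scoped BigOperators

/-- Theta function with characteristic `a`:
`θ_a(w,σ) = Σ_{n∈ℤ} exp(iπσ(n+a)² + 2πi(n+a)w)`. -/
noncomputable def jtheta (a : ℝ) (w σ : ℂ) : ℂ :=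
  ∑' n : ℤ, Complex.exp (Real.pi * Complex.I * σ * ((n : ℂ) + (a : ℂ)) ^ 2 +
    2 * Real.pi * Complex.I * ((n : ℂ) + (a : ℂ)) * w)

/-- The exponentials `x ↦ exp (2πikx)`, `k ∈ ℤ`, are orthonormal on `[0, 1]`. -/
lemma integral_exp_two_pi_I_mul_int (k : ℤ) :
    ∫ x in (0:ℝ)..1, Complex.exp (2 * Real.pi * Complex.I * (k : ℂ) * (x : ℂ)) =
      if k = 0 then 1 else 0 := by
  split_ifs with hk
  · simp [hk]
  · have hc : 2 * Real.pi * Complex.I * (k : ℂ) ≠ 0 :=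
      mul_ne_zero Complex.two_pi_I_ne_zero (by exact_mod_cast hk)
    have h1 : Complex.exp (2 * Real.pi * Complex.I * (k : ℂ)) = 1 := by
      rw [mul_comm]
      exact Complex.exp_int_mul_two_pi_mul_I k
    rw [integral_exp_mul_complex hc]
    simp [h1]

lemma norm_exp_two_pi_I_mul_int (k : ℤ) (x : ℝ) :
    ‖Complex.exp (2 * Real.pi * Complex.I * (k : ℂ) * (x : ℂ))‖ = 1 := by
  rw [Complex.norm_exp]
  simp

lemma conj_exp_two_pi_I_mul_int (k : ℤ) (x : ℝ) :
    (starRingEnd ℂ) (Complex.exp (2 * Real.pi * Complex.I * (k : ℂ) * (x : ℂ))) =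
      Complex.exp (2 * Real.pi * Complex.I * ((-k : ℤ) : ℂ) * (x : ℂ)) := by
  rw [← Complex.exp_conj]
  simp [Complex.conj_ofNat]

/-- Parseval's identity for an absolutely convergent trigonometric series with distinct integer
frequencies. -/
lemma integral_norm_sq_tsum_exp {ι : Type*} [Countable ι] {c : ι → ℂ}
    (hc : Summable fun n => ‖c n‖) {k : ι → ℤ} (hk : Function.Injective k) :
    ∫ x in (0:ℝ)..1, ‖∑' n, c n * Complex.exp (2 * Real.pi * Complex.I * (k n : ℂ) * (x : ℂ))‖ ^ 2 =
      ∑' n, ‖c n‖ ^ 2 := by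
  classical
  have hprod : Summable fun p : ι × ι => ‖c p.1‖ * ‖c p.2‖ :=
    hc.mul_of_nonneg hc (fun _ => norm_nonneg _) (fun _ => norm_nonneg _)
  let F : ι × ι → ℝ → ℂ := fun p x => c p.1 * (starRingEnd ℂ) (c p.2) *
    Complex.exp (2 * Real.pi * Complex.I * ((k p.1 - k p.2 : ℤ) : ℂ) * (x : ℂ))
  have hFnorm (p : ι × ι) (x : ℝ) : ‖F p x‖ = ‖c p.1‖ * ‖c p.2‖ := by
    simp only [F, norm_mul, RCLike.norm_conj, norm_exp_two_pi_I_mul_int, mul_one]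
  have hexpand (x : ℝ) :
      ((‖∑' n, c n * Complex.exp (2 * Real.pi * Complex.I * (k n : ℂ) * (x : ℂ))‖ ^ 2 : ℝ) : ℂ) =
        ∑' p, F p x := by
    have hs : Summable fun n =>
        ‖c n * Complex.exp (2 * Real.pi * Complex.I * (k n : ℂ) * (x : ℂ))‖ := by
      simpa only [norm_mul, norm_exp_two_pi_I_mul_int, mul_one] using hc
    have hs' : Summable fun n => ‖(starRingEnd ℂ)
        (c n * Complex.exp (2 * Real.pi * Complex.I * (k n : ℂ) * (x : ℂ)))‖ := by
      simpa only [RCLike.norm_conj] using hs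
    rw [Complex.ofReal_pow, ← Complex.mul_conj', Complex.conj_tsum,
      tsum_mul_tsum_of_summable_norm hs hs']
    refine tsum_congr fun p => ?_
    rw [map_mul, conj_exp_two_pi_I_mul_int, mul_mul_mul_comm, ← Complex.exp_add]
    simp only [F]
    congr 2
    push_cast
    ring
  have hint : HasSum (fun p => ∫ x in (0:ℝ)..1, F p x) (∫ x in (0:ℝ)..1, ∑' p, F p x) := by
    refine intervalIntegral.hasSum_integral_of_dominated_convergence
      (fun p _ => ‖c p.1‖ * ‖c p.2‖) (fun p => ?_) (fun p => ?_) ?_ ?_ ?_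
    · exact Continuous.aestronglyMeasurable (by fun_prop)
    · exact .of_forall fun x _ => (hFnorm p x).le
    · exact .of_forall fun x _ => hprod
    · exact intervalIntegrable_const
    · refine .of_forall fun x _ => Summable.hasSum (Summable.of_norm ?_)
      simpa only [hFnorm] using hprod
  have hFint (p : ι × ι) :
      ∫ x in (0:ℝ)..1, F p x = if p.2 = p.1 then ((‖c p.1‖ ^ 2 : ℝ) : ℂ) else 0 := by
    simp only [F]
    rw [intervalIntegral.integral_const_mul, integral_exp_two_pi_I_mul_int]
    by_cases h : p.2 = p.1
    · simp [h, Complex.mul_conj']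
    · have : k p.1 - k p.2 ≠ 0 := sub_ne_zero.mpr fun e => h (hk e).symm
      simp [h, this]
  apply Complex.ofReal_injective
  rw [← intervalIntegral.integral_ofReal, Complex.ofReal_tsum]
  simp only [hexpand]
  rw [← hint.tsum_eq, hint.summable.tsum_prod]
  refine tsum_congr fun n => ?_
  simp only [hFint]
  rw [tsum_ite_eq]

lemma norm_exp_pi_I_mul_mul_sq (σ : ℂ) (t : ℝ) :
    ‖Complex.exp (Real.pi * Complex.I * σ * (t : ℂ) ^ 2)‖ = Real.exp (-Real.pi * σ.im * t ^ 2) := by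
  rw [Complex.norm_exp, ← Complex.ofReal_pow, Complex.re_mul_ofReal]
  simp

lemma summable_norm_exp_pi_I_mul_int_add_sq {σ : ℂ} (hσ : 0 < σ.im) (b : ℝ) :
    Summable fun n : ℤ => ‖Complex.exp (Real.pi * Complex.I * σ * ((b + n : ℝ) : ℂ) ^ 2)‖ := by
  have h := (((summable_jacobiTheta₂_term_iff (σ * b) σ).mpr hσ).mul_left
    (Complex.exp (Real.pi * Complex.I * σ * (b : ℂ) ^ 2))).norm
  refine h.congr fun n => ?_
  rw [jacobiTheta₂_term, ← Complex.exp_add]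
  congr 2
  push_cast
  ring

/-- The `x`-integrated probability density of the lowest-Landau-level wavefunction is a sum
of Gaussians centered at the points `-(n + l/N)`:
`∫₀¹ |ψ^{(l)}(x,y)|² dx = Σ_{n∈ℤ} exp(−2πN·Imτ·(y+n+l/N)²)`. -/
theorem stmt_3 (N : ℕ) (hN : 1 ≤ N) (l : ℤ) (τ : ℂ) (hτ : 0 < τ.im)
    (ψ : ℝ → ℝ → ℂ)
    (hψ : ∀ x y : ℝ, ψ x y =
      Complex.exp (Real.pi * Complex.I * (N : ℂ) * τ * (y : ℂ) ^ 2) *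
        jtheta ((l : ℝ) / (N : ℝ)) ((N : ℂ) * ((x : ℂ) + τ * (y : ℂ))) ((N : ℂ) * τ)) :
    ∀ y : ℝ, (∫ x in (0:ℝ)..1, ‖ψ x y‖ ^ 2) =
      ∑' n : ℤ, Real.exp (-2 * Real.pi * (N : ℝ) * τ.im * (y + (n : ℝ) + (l : ℝ) / N) ^ 2) := by
  intro y
  have hN0 : (N : ℂ) ≠ 0 := by
    exact_mod_cast (Nat.one_le_iff_ne_zero.mp hN)
  have hσim : ((N : ℂ) * τ).im = N * τ.im := by simp
  have hσ : 0 < ((N : ℂ) * τ).im := by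
    rw [hσim]
    have : (0 : ℝ) < N := by exact_mod_cast hN
    positivity
  have hk : Function.Injective fun n : ℤ => n * (N : ℤ) + l := fun m n h => by
    have : N ≠ 0 := by omega
    simpa [this] using h
  have hseries (x : ℝ) : ψ x y = ∑' n : ℤ,
      Complex.exp (Real.pi * Complex.I * (N * τ) * ((y + (l : ℝ) / N + n : ℝ) : ℂ) ^ 2) *
        Complex.exp (2 * Real.pi * Complex.I * ((n * (N : ℤ) + l : ℤ) : ℂ) * (x : ℂ)) := by
    rw [hψ, jtheta, ← tsum_mul_left]
    refine tsum_congr fun n => ?_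
    rw [← Complex.exp_add, ← Complex.exp_add]
    congr 1
    push_cast
    field_simp
    ring
  simp only [hseries]
  rw [integral_norm_sq_tsum_exp (summable_norm_exp_pi_I_mul_int_add_sq hσ (y + (l : ℝ) / N)) hk]
  refine tsum_congr fun n => ?_
  rw [norm_exp_pi_I_mul_mul_sq, ← Real.exp_nat_mul, hσim]
  congr 1
  push_cast
  ring
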